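/- arXiv:0906.4660 — 2 statements merged into one kernel-verified Lean document; each statement's English description precedes it below -/
import Mathlib

section
/- Theorem 5.1 (ii): let q, h, a, σ, κ be a Frenet frame of a spacelike ruled surface of type M₊², let c : ℝ → ℝ³ be smooth with c'(s) = q(s) for all s, let R be a nonzero real constant, let θ : ℝ → ℝ be smooth, and set c*(s) = c(s) + R a(s) and q*(s) = cosh θ(s) q(s) + sinh θ(s) h(s) (the spacelike ruling of a Mannheim offset of type M₊¹). Then there exists a function μ : ℝ → ℝ with c*'(s) = μ(s) q*(s) for all s (i.e. the offset is developable) if and only if sinh θ(s) - R κ(s) σ(s) cosh θ(s) = 0 for all s. -/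
noncomputable section

/-- The Minkowski bilinear form on ℝ³: ⟨x,y⟩ = -x₁y₁ + x₂y₂ + x₃y₃. -/
def mink (x y : Fin 3 → ℝ) : ℝ := -(x 0 * y 0) + x 1 * y 1 + x 2 * y 2

/-- The Minkowski norm ‖v‖ = √|⟨v,v⟩|. -/
def mnorm (v : Fin 3 → ℝ) : ℝ := Real.sqrt |mink v v|

/-- The determinant of three vectors in ℝ³. -/
def det3 (u v w : Fin 3 → ℝ) : ℝ :=
  u 0 * (v 1 * w 2 - v 2 * w 1) - u 1 * (v 0 * w 2 - v 2 * w 0)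
    + u 2 * (v 0 * w 1 - v 1 * w 0)

/-- A Frenet frame of a spacelike ruled surface of type M₊² in Minkowski 3-space:
orthonormal fields `q` (spacelike ruling), `h` (timelike central normal),
`a` (spacelike asymptotic normal), with `σ = ds₁/ds > 0` and conical curvature `κ`,
satisfying the Frenet equations q' = σh, h' = σ(q + κa), a' = σκh. -/
structure FrenetFrameM2 where
  q : ℝ → Fin 3 → ℝ
  h : ℝ → Fin 3 → ℝ
  a : ℝ → Fin 3 → ℝ
  σ : ℝ → ℝ
  κ : ℝ → ℝ
  smooth_q : ContDiff ℝ (⊤ : ℕ∞) q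
  smooth_h : ContDiff ℝ (⊤ : ℕ∞) h
  smooth_a : ContDiff ℝ (⊤ : ℕ∞) a
  smooth_σ : ContDiff ℝ (⊤ : ℕ∞) σ
  smooth_κ : ContDiff ℝ (⊤ : ℕ∞) κ
  hqq : ∀ s, mink (q s) (q s) = 1
  hhh : ∀ s, mink (h s) (h s) = -1
  haa : ∀ s, mink (a s) (a s) = 1
  hqh : ∀ s, mink (q s) (h s) = 0
  hqa : ∀ s, mink (q s) (a s) = 0
  hha : ∀ s, mink (h s) (a s) = 0
  σ_pos : ∀ s, 0 < σ s
  frenet_q : ∀ s, deriv q s = σ s • h s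
  frenet_h : ∀ s, deriv h s = σ s • (q s + κ s • a s)
  frenet_a : ∀ s, deriv a s = (σ s * κ s) • h s

theorem mink_add_smul_left (x y z : Fin 3 → ℝ) (r t : ℝ) :
    mink (r • x + t • y) z = r * mink x z + t * mink y z := by
  simp only [mink, Pi.add_apply, Pi.smul_apply, smul_eq_mul]
  ring

theorem mink_comm (x y : Fin 3 → ℝ) : mink x y = mink y x := by
  simp only [mink]
  ring

namespace FrenetFrameM2

/-- The coefficients of a vector in the span of `q` and `h` are unique. -/
theorem coeff_eq (F : FrenetFrameM2) {s r t r' t' : ℝ}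
    (e : r • F.q s + t • F.h s = r' • F.q s + t' • F.h s) : r = r' ∧ t = t' := by
  have eq := congrArg (fun v => mink v (F.q s)) e
  have eh := congrArg (fun v => mink v (F.h s)) e
  simp only [mink_add_smul_left, mink_comm (F.h s) (F.q s), F.hqq, F.hqh, F.hhh] at eq eh
  constructor <;> linarith

theorem deriv_offset (F : FrenetFrameM2) {c : ℝ → Fin 3 → ℝ} {s : ℝ}
    (hc : DifferentiableAt ℝ c s) (hcq : deriv c s = F.q s) (R : ℝ) :
    deriv (fun t => c t + R • F.a t) s
      = (1 : ℝ) • F.q s + (R * F.κ s * F.σ s) • F.h s := by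
  have ha : HasDerivAt F.a ((F.σ s * F.κ s) • F.h s) s :=
    F.frenet_a s ▸ (F.smooth_a.differentiable (by simp) s).hasDerivAt
  rw [(hc.hasDerivAt.fun_add (ha.fun_const_smul R)).deriv, hcq, one_smul, smul_smul]
  congr 2
  ring

end FrenetFrameM2

/-- Theorem 5.1 (ii): the Mannheim offset of type M₊¹, with striction curve c + R a and
ruling q* = cosh θ q + sinh θ h, of a developable spacelike ruled surface of type M₊²
is developable iff sinh θ - Rκσ cosh θ = 0. -/
theorem mannheim_offset_M1plus_developable_iff (F : FrenetFrameM2)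
    (c : ℝ → Fin 3 → ℝ) (hc : ContDiff ℝ (⊤ : ℕ∞) c)
    (hcq : ∀ s, deriv c s = F.q s)
    (R : ℝ) (hR : R ≠ 0) (θ : ℝ → ℝ) (hθ : ContDiff ℝ (⊤ : ℕ∞) θ) :
    (∃ μ : ℝ → ℝ, ∀ s, deriv (fun t => c t + R • F.a t) s
        = μ s • (Real.cosh (θ s) • F.q s + Real.sinh (θ s) • F.h s)) ↔
      (∀ s, Real.sinh (θ s) - R * F.κ s * F.σ s * Real.cosh (θ s) = 0) := by
  have hd (s : ℝ) := F.deriv_offset (hc.differentiable (by simp) s) (hcq s) R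
  simp only [hd, smul_add, smul_smul]
  constructor
  · rintro ⟨μ, hμ⟩ s
    obtain ⟨h₁, h₂⟩ := F.coeff_eq (hμ s)
    rw [h₂]
    linear_combination Real.sinh (θ s) * h₁
  · intro H
    refine ⟨fun s => (Real.cosh (θ s))⁻¹, fun s => ?_⟩
    have hcosh := (Real.cosh_pos (θ s)).ne'
    rw [inv_mul_cancel₀ hcosh, sub_eq_zero.mp (H s), mul_comm _ (Real.cosh (θ s)),
      inv_mul_cancel_left₀ hcosh]
end
end

section
/- Corollary 5.4 (b), type M₊¹ case (equation (41)): let q, h, a, σ, κ be a Frenet frame of a spacelike ruled surface of type M₊², let c : ℝ → ℝ³ be smooth with c'(s) = q(s) for all s, let R be a nonzero real constant with κ(s) ≠ 0 for all s, let θ : ℝ → ℝ be smooth with θ'(s) = -σ(s) for all s, and set c*(s) = c(s) + R a(s) and a*(s) = sinh θ(s) q(s) + cosh θ(s) h(s) (the asymptotic normal of the Mannheim offset of type M₊¹). Then the trajectory ruled surface φ_{a*}(s,v) = c*(s) + v a*(s) is developable, i.e. det(c*'(s), a*(s), a*'(s)) = 0 for all s, if and only if -cosh θ(s) + R κ(s)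 σ(s) sinh θ(s) = 0 for all s. -/
noncomputable section

/-- The square of the determinant is minus the Gram determinant of the Minkowski form. -/
lemma det3_sq_eq_neg_gram (u v w : Fin 3 → ℝ) :
    det3 u v w ^ 2 = -(mink u u * (mink v v * mink w w - mink v w ^ 2)
      - mink u v * (mink u v * mink w w - mink v w * mink u w)
      + mink u w * (mink u v * mink v w - mink v v * mink u w)) := by
  simp only [det3, mink]
  ring

lemma FrenetFrameM2.det3_ne_zero (F : FrenetFrameM2) (s : ℝ) :
    det3 (F.q s) (F.h s) (F.a s) ≠ 0 := by
  intro h0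
  have := det3_sq_eq_neg_gram (F.q s) (F.h s) (F.a s)
  rw [h0, F.hqq, F.hhh, F.haa, F.hqh, F.hqa, F.hha] at this
  norm_num at this

lemma det3_add_smul_add_smul_smul (u v w : Fin 3 → ℝ) (b x y z : ℝ) :
    det3 (u + b • v) (x • u + y • v) (z • w) = z * (y - b * x) * det3 u v w := by
  simp only [det3, Pi.add_apply, Pi.smul_apply, smul_eq_mul]
  ring

lemma FrenetFrameM2.hasDerivAt_q (F : FrenetFrameM2) (s : ℝ) :
    HasDerivAt F.q (F.σ s • F.h s) s :=
  F.frenet_q s ▸ (F.smooth_q.differentiable (by simp) s).hasDerivAt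

lemma FrenetFrameM2.hasDerivAt_h (F : FrenetFrameM2) (s : ℝ) :
    HasDerivAt F.h (F.σ s • (F.q s + F.κ s • F.a s)) s :=
  F.frenet_h s ▸ (F.smooth_h.differentiable (by simp) s).hasDerivAt

lemma FrenetFrameM2.hasDerivAt_a (F : FrenetFrameM2) (s : ℝ) :
    HasDerivAt F.a ((F.σ s * F.κ s) • F.h s) s :=
  F.frenet_a s ▸ (F.smooth_a.differentiable (by simp) s).hasDerivAt

lemma FrenetFrameM2.hasDerivAt_add_smul_a (F : FrenetFrameM2) {c : ℝ → Fin 3 → ℝ} {s : ℝ}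
    (hc : HasDerivAt c (F.q s) s) (R : ℝ) :
    HasDerivAt (fun t => c t + R • F.a t) (F.q s + (R * F.κ s * F.σ s) • F.h s) s := by
  refine (hc.add ((F.hasDerivAt_a s).const_smul R)).congr_deriv ?_
  module

lemma FrenetFrameM2.hasDerivAt_sinh_smul_q_add_cosh_smul_h (F : FrenetFrameM2) {θ : ℝ → ℝ}
    {s : ℝ} (hθ : HasDerivAt θ (-F.σ s) s) :
    HasDerivAt (fun t => Real.sinh (θ t) • F.q t + Real.cosh (θ t) • F.h t)
      ((F.σ s * F.κ s * Real.cosh (θ s)) • F.a s) s := by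
  refine ((hθ.sinh.smul (F.hasDerivAt_q s)).add
    (hθ.cosh.smul (F.hasDerivAt_h s))).congr_deriv ?_
  module

/-- Corollary 5.4 (b), type M₊¹ case (equation (41)): the trajectory surface
φ_{a*}(s,v) = c*(s) + v a*(s) with a* = sinh θ q + cosh θ h is developable iff
-cosh θ + Rκσ sinh θ = 0. -/
theorem trajectory_surface_a_developable_M1plus (F : FrenetFrameM2)
    (c : ℝ → Fin 3 → ℝ) (hc : ContDiff ℝ (⊤ : ℕ∞) c)
    (hcq : ∀ s, deriv c s = F.q s)
    (R : ℝ) (hR : R ≠ 0) (hκ : ∀ s, F.κ s ≠ 0)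
    (θ : ℝ → ℝ) (hθ : ContDiff ℝ (⊤ : ℕ∞) θ)
    (hθ' : ∀ s, deriv θ s = -F.σ s)
    (cst ast : ℝ → Fin 3 → ℝ)
    (hcst : cst = fun s => c s + R • F.a s)
    (hast : ast = fun s => Real.sinh (θ s) • F.q s + Real.cosh (θ s) • F.h s) :
    (∀ s, det3 (deriv cst s) (ast s) (deriv ast s) = 0) ↔
      (∀ s, -Real.cosh (θ s) + R * F.κ s * F.σ s * Real.sinh (θ s) = 0) := by
  have hcst' (s : ℝ) : deriv cst s = F.q s + (R * F.κ s * F.σ s) • F.h s := by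
    rw [hcst]
    exact (F.hasDerivAt_add_smul_a
      (hcq s ▸ (hc.differentiable (by simp) s).hasDerivAt) R).deriv
  have hast' (s : ℝ) : deriv ast s = (F.σ s * F.κ s * Real.cosh (θ s)) • F.a s := by
    rw [hast]
    exact (F.hasDerivAt_sinh_smul_q_add_cosh_smul_h
      (hθ' s ▸ (hθ.differentiable (by simp) s).hasDerivAt)).deriv
  refine forall_congr' fun s => ?_
  have hz : F.σ s * F.κ s * Real.cosh (θ s) ≠ 0 :=
    mul_ne_zero (mul_ne_zero (F.σ_pos s).ne' (hκ s)) (Real.cosh_pos _).ne'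
  rw [hcst', hast', congrFun hast s, det3_add_smul_add_smul_smul,
    mul_eq_zero_iff_right (F.det3_ne_zero s), mul_eq_zero_iff_left hz,
    sub_eq_zero, neg_add_eq_zero]
end
end
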